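/- arXiv:math/0402237 — 2 statements merged into one kernel-verified Lean document; each statement's English description precedes it below -/
import Mathlib

section
/- Let g : ℝ^m → ℝ be a smooth function and define G : A^m → A by G(X) = Σ_{|p| < n} (1/p!)·D^p g(π(X))·(X − π(X)·1)^p, where π(X) = (π(X¹), …, π(X^m)) ∈ ℝ^m. Then G is A-differentiable: it is infinitely Fréchet differentiable and its Fréchet derivative at every point X ∈ A^m is A-linear. Moreover π(G(X)) = g(π(X)) for all X ∈ A^m, i.e. the real part of G is g. -/
/-- The partial derivative `∂g/∂x^j` of a function `g : ℝ^m → ℝ`. -/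
noncomputable def partialDeriv' {m : ℕ} (j : Fin m) (g : (Fin m → ℝ) → ℝ) :
    (Fin m → ℝ) → ℝ :=
  fun x => fderiv ℝ g x (Pi.single j 1)

/-- The iterated partial derivative `D^p g = ∂^{|p|} g / (∂x¹)^{p₁} ⋯ (∂x^m)^{p_m}`
associated with a multi-index `p`. -/
noncomputable def multiDeriv {m : ℕ} (p : Fin m → ℕ) (g : (Fin m → ℝ) → ℝ) :
    (Fin m → ℝ) → ℝ :=
  Fin.foldr m (fun j h => (partialDeriv' j)^[p j] h) g

/-- A map `G : A^m → A` is `A`-differentiable if it is infinitely (Fréchet)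
differentiable and its Fréchet derivative at every point is `A`-linear. -/
def ADiff {A : Type*} [NormedCommRing A] [NormedAlgebra ℝ A] {m : ℕ}
    (G : (Fin m → A) → A) : Prop :=
  ContDiff ℝ (⊤ : ℕ∞) G ∧
    ∀ (X : Fin m → A) (a : A) (v : Fin m → A),
      fderiv ℝ G X (a • v) = a • fderiv ℝ G X v

section helpers

open Finset

lemma te_pd_smooth {m : ℕ} (j : Fin m) {g : (Fin m → ℝ) → ℝ} (hg : ContDiff ℝ (⊤ : ℕ∞) g) :
    ContDiff ℝ (⊤ : ℕ∞) (partialDeriv' j g) := by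
  unfold partialDeriv'
  exact (hg.fderiv_right (m := (⊤ : ℕ∞)) (by simp)).clm_apply contDiff_const

lemma te_pd_iter_smooth {m : ℕ} (j : Fin m) (k : ℕ) {g : (Fin m → ℝ) → ℝ}
    (hg : ContDiff ℝ (⊤ : ℕ∞) g) :
    ContDiff ℝ (⊤ : ℕ∞) ((partialDeriv' j)^[k] g) := by
  induction k with
  | zero => simpa using hg
  | succ k ih =>
    rw [Function.iterate_succ_apply']
    exact te_pd_smooth j ih

lemma te_pd_comm {m : ℕ} (i j : Fin m) {g : (Fin m → ℝ) → ℝ} (hg : ContDiff ℝ (⊤ : ℕ∞) g) :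
    partialDeriv' i (partialDeriv' j g) = partialDeriv' j (partialDeriv' i g) := by
  funext x
  have hd : DifferentiableAt ℝ (fderiv ℝ g) x :=
    ((hg.fderiv_right (m := (⊤ : ℕ∞)) (by simp)).differentiable (by simp)) x
  have hs : IsSymmSndFDerivAt ℝ g x := hg.contDiffAt.isSymmSndFDerivAt (by
    simp only [minSmoothness_of_isRCLikeNormedField]
    exact WithTop.coe_le_coe.2 (le_top : (2 : ℕ∞) ≤ ⊤))
  unfold partialDeriv'
  rw [fderiv_clm_apply hd (differentiableAt_const _), fderiv_clm_apply hd (differentiableAt_const _)]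
  simpa using hs (Pi.single i 1) (Pi.single j 1)

lemma te_pd_iter_comm {m : ℕ} (i j : Fin m) (k : ℕ) {g : (Fin m → ℝ) → ℝ}
    (hg : ContDiff ℝ (⊤ : ℕ∞) g) :
    partialDeriv' i ((partialDeriv' j)^[k] g) = (partialDeriv' j)^[k] (partialDeriv' i g) := by
  induction k with
  | zero => rfl
  | succ k ih =>
    rw [Function.iterate_succ_apply', Function.iterate_succ_apply', ← ih,
      te_pd_comm i j (te_pd_iter_smooth j k hg)]

lemma te_list_smooth {m : ℕ} (p : Fin m → ℕ) (l : List (Fin m)) {g : (Fin m → ℝ) → ℝ}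
    (hg : ContDiff ℝ (⊤ : ℕ∞) g) :
    ContDiff ℝ (⊤ : ℕ∞) (l.foldr (fun j h => (partialDeriv' j)^[p j] h) g) := by
  induction l with
  | nil => simpa using hg
  | cons a l ih =>
    rw [List.foldr_cons]
    exact te_pd_iter_smooth a _ ih

lemma te_list_congr {m : ℕ} (p q : Fin m → ℕ) (l : List (Fin m)) (h : ∀ j ∈ l, p j = q j)
    (g : (Fin m → ℝ) → ℝ) :
    l.foldr (fun j h => (partialDeriv' j)^[p j] h) g
      = l.foldr (fun j h => (partialDeriv' j)^[q j] h) g := by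
  induction l with
  | nil => rfl
  | cons a l ih =>
    rw [List.foldr_cons, List.foldr_cons, h a (by simp),
      ih (fun j hj => h j (List.mem_cons_of_mem _ hj))]

lemma te_list_pd {m : ℕ} (p : Fin m → ℕ) (i : Fin m) (l : List (Fin m)) (hl : l.Nodup)
    (hi : i ∈ l) {g : (Fin m → ℝ) → ℝ} (hg : ContDiff ℝ (⊤ : ℕ∞) g) :
    partialDeriv' i (l.foldr (fun j h => (partialDeriv' j)^[p j] h) g)
      = l.foldr (fun j h => (partialDeriv' j)^[(p + (Pi.single i 1 : Fin m → ℕ)) j] h) g := by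
  induction l with
  | nil => simp at hi
  | cons a l ih =>
    rw [List.nodup_cons] at hl
    rw [List.foldr_cons, List.foldr_cons]
    by_cases hia : i = a
    · subst hia
      rw [te_list_congr (p + Pi.single i 1) p l (fun j hj => ?_)]
      · have e : (p + (Pi.single i 1 : Fin m → ℕ)) i = p i + 1 := by simp
        rw [e, Function.iterate_succ_apply']
      · have : j ≠ i := fun h => hl.1 (h ▸ hj)
        simp [this]
    · have hi' : i ∈ l := by simpa [hia] using hi
      rw [te_pd_iter_comm i a _ (te_list_smooth p l hg), ih hl.2 hi']
      have : a ≠ i := fun h => hia h.symm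
      simp [this]

lemma te_multi_smooth {m : ℕ} (p : Fin m → ℕ) {g : (Fin m → ℝ) → ℝ}
    (hg : ContDiff ℝ (⊤ : ℕ∞) g) : ContDiff ℝ (⊤ : ℕ∞) (multiDeriv p g) := by
  unfold multiDeriv
  rw [Fin.foldr_eq_finRange_foldr]
  exact te_list_smooth p _ hg

lemma te_multi_pd {m : ℕ} (p : Fin m → ℕ) (i : Fin m) {g : (Fin m → ℝ) → ℝ}
    (hg : ContDiff ℝ (⊤ : ℕ∞) g) :
    partialDeriv' i (multiDeriv p g) = multiDeriv (p + Pi.single i 1) g := by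
  unfold multiDeriv
  rw [Fin.foldr_eq_finRange_foldr, Fin.foldr_eq_finRange_foldr]
  exact te_list_pd p i _ (List.nodup_finRange m) (List.mem_finRange i) hg

lemma te_multi_zero {m : ℕ} (g : (Fin m → ℝ) → ℝ) : multiDeriv 0 g = g := by
  unfold multiDeriv
  rw [Fin.foldr_eq_finRange_foldr]
  induction List.finRange m with
  | nil => rfl
  | cons a l ih => rw [List.foldr_cons, ih]; rfl

lemma te_multi_fderiv {m : ℕ} (p : Fin m → ℕ) {g : (Fin m → ℝ) → ℝ}
    (hg : ContDiff ℝ (⊤ : ℕ∞) g) (x w : Fin m → ℝ) :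
    fderiv ℝ (multiDeriv p g) x w = ∑ j, w j * multiDeriv (p + Pi.single j 1) g x := by
  conv_lhs => rw [pi_eq_sum_univ' w]
  rw [map_sum]
  refine sum_congr rfl fun j _ => ?_
  rw [map_smul, smul_eq_mul, ← te_multi_pd p j hg]
  rfl

lemma te_pow_bot {A : Type*} [CommRing A] [Algebra ℝ A] [FiniteDimensional ℝ A] [IsLocalRing A] :
    (IsLocalRing.maximalIdeal A) ^ (Module.finrank ℝ A) = ⊥ := by
  have : IsNoetherianRing A := isNoetherian_of_tower ℝ inferInstance
  have key : ∀ k : ℕ, (IsLocalRing.maximalIdeal A) ^ k = ⊥ ∨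
      Module.finrank ℝ (((IsLocalRing.maximalIdeal A) ^ k).restrictScalars ℝ) + k
        ≤ Module.finrank ℝ A := by
    intro k
    induction k with
    | zero => right; simpa using Submodule.finrank_le _
    | succ k ih =>
      rcases ih with h | h
      · left; rw [pow_succ, h]; simp
      · by_cases hb : (IsLocalRing.maximalIdeal A) ^ k = ⊥
        · left; rw [pow_succ, hb]; simp
        right
        have hlt : (IsLocalRing.maximalIdeal A) ^ (k + 1) < (IsLocalRing.maximalIdeal A) ^ k := by
          refine lt_of_le_of_ne (Ideal.pow_le_pow_right (Nat.le_succ k)) fun he => hb ?_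
          refine Submodule.eq_bot_of_le_smul_of_le_jacobson_bot (IsLocalRing.maximalIdeal A) _
            (IsNoetherian.noetherian _) ?_ ?_
          · rw [smul_eq_mul, ← pow_succ', he]
          · rw [IsLocalRing.jacobson_eq_maximalIdeal _ bot_ne_top]
        have := Submodule.finrank_lt_finrank_of_lt (K := ℝ)
          (s := ((IsLocalRing.maximalIdeal A) ^ (k + 1)).restrictScalars ℝ)
          (t := ((IsLocalRing.maximalIdeal A) ^ k).restrictScalars ℝ) hlt
        omega
  rcases key (Module.finrank ℝ A) with h | h
  · exact h
  · have h0 : Module.finrank ℝ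
      (((IsLocalRing.maximalIdeal A) ^ (Module.finrank ℝ A)).restrictScalars ℝ) = 0 := by omega
    rw [Submodule.finrank_eq_zero] at h0
    exact (Submodule.restrictScalars_eq_bot_iff _ _ _).1 h0

lemma te_prod_zero {A : Type*} [CommRing A] [Algebra ℝ A] [FiniteDimensional ℝ A] [IsLocalRing A]
    {m : ℕ} (N : Fin m → A) (hN : ∀ j, N j ∈ IsLocalRing.maximalIdeal A) (p : Fin m → ℕ)
    (hp : Module.finrank ℝ A ≤ ∑ j, p j) : ∏ j, N j ^ p j = 0 := by
  have h1 : ∏ j, N j ^ p j ∈ ∏ j, (IsLocalRing.maximalIdeal A) ^ p j :=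
    Ideal.prod_mem_prod fun j _ => Ideal.pow_mem_pow (hN j) _
  rw [Finset.prod_pow_eq_pow_sum] at h1
  have h2 := Ideal.pow_le_pow_right hp h1
  rwa [te_pow_bot] at h2

/-- Multi-indices of total degree less than `M`. -/
def teS (m M : ℕ) : Finset (Fin m → ℕ) :=
  (Fintype.piFinset fun _ => range M).filter fun p => ∑ j, p j < M

lemma te_mem_S {m M : ℕ} (p : Fin m → ℕ) : p ∈ teS m M ↔ ∑ j, p j < M := by
  unfold teS
  rw [mem_filter, Fintype.mem_piFinset]
  refine ⟨fun h => h.2, fun h => ⟨fun j => mem_range.2 (lt_of_le_of_lt ?_ h), h⟩⟩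
  exact single_le_sum (f := p) (fun _ _ => Nat.zero_le _) (mem_univ j)

/-- The sum identity obtained by shifting the index. -/
lemma te_shift {A : Type*} [CommRing A] [Algebra ℝ A] {m : ℕ} (M : ℕ) (N : Fin m → A)
    (d : (Fin m → ℕ) → ℝ) (j : Fin m) :
    ∑ p ∈ teS m (M + 1), (((∏ i, (p i).factorial : ℕ) : ℝ)⁻¹ * d p) •
        ((∏ i ∈ univ.erase j, N i ^ p i) * ((p j : A) * N j ^ (p j - 1)))
      = ∑ p ∈ teS m M, (((∏ i, (p i).factorial : ℕ) : ℝ)⁻¹ * d (p + Pi.single j 1)) •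
        ∏ i, N i ^ p i := by
  symm
  refine sum_of_injOn (fun p => p + Pi.single j 1) ?_ ?_ ?_ ?_
  · intro p _ q _ h
    exact add_right_cancel h
  · intro p hp
    have hp' := (te_mem_S p).1 hp
    refine (te_mem_S _).2 ?_
    simp [sum_add_distrib, hp']
  · intro p hp hn
    have h0 : p j = 0 := by
      by_contra h0
      refine hn ⟨p - Pi.single j 1, ?_, ?_⟩
      · have hle : Pi.single j 1 ≤ p := by
          intro i
          by_cases h : i = j
          · subst h; simp; omega
          · simp [h]
        have he : p - Pi.single j 1 + Pi.single j 1 = p := tsub_add_cancel_of_le hle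
        have := (te_mem_S p).1 hp
        rw [← he] at this
        refine (te_mem_S _).2 ?_
        simp only [Pi.add_apply, sum_add_distrib, sum_pi_single', mem_univ, if_true] at this
        simp at this
        simpa using this
      · have hle : Pi.single j 1 ≤ p := by
          intro i
          by_cases h : i = j
          · subst h; simp; omega
          · simp [h]
        exact tsub_add_cancel_of_le hle
    simp [h0]
  · intro p _
    have e1 : ∏ i ∈ univ.erase j, N i ^ ((p + (Pi.single j 1 : Fin m → ℕ)) i) = ∏ i ∈ univ.erase j, N i ^ p i :=
      prod_congr rfl fun i hi => by simp [ne_of_mem_erase hi]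
    have e2 : ∏ i ∈ univ.erase j, ((p + (Pi.single j 1 : Fin m → ℕ)) i).factorial
        = ∏ i ∈ univ.erase j, (p i).factorial :=
      prod_congr rfl fun i hi => by simp [ne_of_mem_erase hi]
    have e3 : (p + (Pi.single j 1 : Fin m → ℕ)) j = p j + 1 := by simp
    rw [← mul_prod_erase univ (fun i => N i ^ p i) (mem_univ j),
      ← mul_prod_erase univ (fun i => (p i).factorial) (mem_univ j),
      ← mul_prod_erase univ (fun i => ((p + (Pi.single j 1 : Fin m → ℕ)) i).factorial) (mem_univ j), e1, e2, e3]
    have e4 : ((p j + 1 : ℕ) : A) = algebraMap ℝ A ((p j : ℝ) + 1) := by simp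
    rw [e4, Nat.add_sub_cancel, Algebra.smul_def, Algebra.smul_def, Nat.factorial_succ]
    have e5 : ((((p j + 1) * (p j).factorial * ∏ i ∈ univ.erase j, (p i).factorial : ℕ) : ℝ)⁻¹
        * d (p + Pi.single j 1)) * ((p j : ℝ) + 1)
        = (((p j).factorial * ∏ i ∈ univ.erase j, (p i).factorial : ℕ) : ℝ)⁻¹
        * d (p + Pi.single j 1) := by
      push_cast
      have : ((p j : ℝ) + 1) ≠ 0 := by positivity
      have : ((p j).factorial : ℝ) ≠ 0 := by positivity
      have : (∏ i ∈ univ.erase j, ((p i).factorial : ℝ)) ≠ 0 := by positivity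
      field_simp
    rw [← e5, map_mul]
    ring

end helpers

/-- Given a smooth `g : ℝ^m → ℝ`, the function
`G X = Σ_{|p| < n} (1/p!) · D^p g (π X) · (X − π X · 1)^p` is `A`-differentiable and its
real part is `g`, i.e. `π (G X) = g (π X)` for all `X`. -/
theorem taylor_extension_ADiff
    {A : Type*} [NormedCommRing A] [NormedAlgebra ℝ A] [FiniteDimensional ℝ A]
    [IsLocalRing A]
    (π : A →ₐ[ℝ] ℝ) (hπ : RingHom.ker (π : A →+* ℝ) = IsLocalRing.maximalIdeal A)
    {m : ℕ} (g : (Fin m → ℝ) → ℝ) (hg : ContDiff ℝ (⊤ : ℕ∞) g)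
    (G : (Fin m → A) → A)
    (hGdef : ∀ X : Fin m → A,
      G X = ∑ᶠ (p : Fin m → ℕ) (_ : ∑ j, p j < Module.finrank ℝ A),
        (((∏ j, (p j).factorial : ℕ) : ℝ)⁻¹ *
            multiDeriv p g (fun j => π (X j))) •
          ∏ j, (X j - algebraMap ℝ A (π (X j))) ^ p j) :
    ADiff G ∧ ∀ X : Fin m → A, π (G X) = g (fun j => π (X j)) := by
  classical
  set n := Module.finrank ℝ A with hn
  let πc : A →L[ℝ] ℝ := LinearMap.toContinuousLinearMap π.toLinearMap
  have hπc : ∀ a, πc a = π a := fun _ => rfl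
  have hπs : ContDiff ℝ (⊤ : ℕ∞) (fun a : A => π a) := πc.contDiff
  have hac : ContDiff ℝ (⊤ : ℕ∞) (fun r : ℝ => algebraMap ℝ A r) :=
    (algebraMapCLM ℝ A).contDiff
  have hN : ∀ a : A, a - algebraMap ℝ A (π a) ∈ IsLocalRing.maximalIdeal A := by
    intro a
    rw [← hπ, RingHom.mem_ker]
    simp
  have hG : ∀ X : Fin m → A, G X = ∑ p ∈ teS m (n + 1),
        (((∏ j, (p j).factorial : ℕ) : ℝ)⁻¹ *
            multiDeriv p g (fun j => π (X j))) •
          ∏ j, (X j - algebraMap ℝ A (π (X j))) ^ p j := by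
    intro X
    rw [hGdef X]
    refine finsum_cond_eq_sum_of_cond_iff _ fun {p} hp => ?_
    rw [te_mem_S]
    refine ⟨fun h => by omega, fun _ => ?_⟩
    by_contra hlt
    exact hp (by rw [te_prod_zero _ (fun j => hN (X j)) p (not_lt.1 hlt), smul_zero])
  have hsm : ContDiff ℝ (⊤ : ℕ∞) G := by
    rw [funext hG]
    refine ContDiff.sum fun p _ => ContDiff.fun_smul ?_ ?_
    · refine contDiff_const.mul ((te_multi_smooth p hg).comp (contDiff_pi.2 fun j => ?_))
      exact hπs.comp (contDiff_apply ℝ A j)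
    · refine contDiff_prod fun j _ => ContDiff.pow ?_ _
      exact (contDiff_apply ℝ A j).sub (hac.comp (hπs.comp (contDiff_apply ℝ A j)))
  have hD : ∀ X v : Fin m → A, fderiv ℝ G X v = ∑ j, v j * ∑ p ∈ teS m n,
        (((∏ i, (p i).factorial : ℕ) : ℝ)⁻¹ *
            multiDeriv (p + Pi.single j 1) g (fun i => π (X i))) •
          ∏ i, (X i - algebraMap ℝ A (π (X i))) ^ p i := by
    intro X v
    set x : Fin m → ℝ := fun i => π (X i) with hx
    set N : Fin m → A := fun i => X i - algebraMap ℝ A (π (X i)) with hNdef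
    set w : Fin m → ℝ := fun i => π (v i) with hw
    set u : Fin m → A := fun i => v i - algebraMap ℝ A (π (v i)) with hu
    have hline : HasDerivAt (fun t : ℝ => X + t • v) v 0 := by
      simpa using ((hasDerivAt_id (0 : ℝ)).smul_const v).const_add X
    have h1 : HasDerivAt (fun t : ℝ => G (X + t • v)) (fderiv ℝ G X v) 0 := by
      have hd : HasFDerivAt G (fderiv ℝ G X) (X + (0 : ℝ) • v) := by
        simpa using ((hsm.differentiable (by simp)) X).hasFDerivAt
      exact hd.comp_hasDerivAt (0 : ℝ) hline
    have hGl : (fun t : ℝ => G (X + t • v)) = fun t : ℝ => ∑ p ∈ teS m (n + 1),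
        (((∏ j, (p j).factorial : ℕ) : ℝ)⁻¹ * multiDeriv p g (x + t • w)) •
          ∏ j, (N j + t • u j) ^ p j := by
      funext t
      rw [hG]
      refine Finset.sum_congr rfl fun p _ => ?_
      congr 1
      · congr 2
        funext j
        simp [hx, hw]
      · refine Finset.prod_congr rfl fun j _ => ?_
        congr 1
        simp only [hNdef, hu, Pi.add_apply, Pi.smul_apply, map_add, map_smul, smul_sub,
          smul_eq_mul, map_mul]
        simp only [Algebra.smul_def]
        ring
    have h2 : HasDerivAt (fun t : ℝ => ∑ p ∈ teS m (n + 1),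
        (((∏ j, (p j).factorial : ℕ) : ℝ)⁻¹ * multiDeriv p g (x + t • w)) •
          ∏ j, (N j + t • u j) ^ p j)
        (∑ p ∈ teS m (n + 1),
          ((((∏ j, (p j).factorial : ℕ) : ℝ)⁻¹ * multiDeriv p g x) •
            (∑ j, (∏ i ∈ Finset.univ.erase j, N i ^ p i) * ((p j : A) * N j ^ (p j - 1) * u j))
          + (((∏ j, (p j).factorial : ℕ) : ℝ)⁻¹ *
              ∑ j, w j * multiDeriv (p + Pi.single j 1) g x) • ∏ j, N j ^ p j)) 0 := by
      refine HasDerivAt.fun_sum fun p _ => ?_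
      have hl2 : HasDerivAt (fun t : ℝ => x + t • w) w 0 := by
        simpa using ((hasDerivAt_id (0 : ℝ)).smul_const w).const_add x
      have ha : HasDerivAt (fun t : ℝ => multiDeriv p g (x + t • w))
          (∑ j, w j * multiDeriv (p + Pi.single j 1) g x) 0 := by
        rw [← te_multi_fderiv p hg]
        have hd : HasFDerivAt (multiDeriv p g) (fderiv ℝ (multiDeriv p g) x)
            (x + (0 : ℝ) • w) := by
          simpa using (((te_multi_smooth p hg).differentiable (by simp)) x).hasFDerivAt
        exact hd.comp_hasDerivAt (0 : ℝ) hl2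
      have hb : ∀ j ∈ (Finset.univ : Finset (Fin m)),
          HasDerivAt (fun t : ℝ => (N j + t • u j) ^ p j)
          ((p j : A) * N j ^ (p j - 1) * u j) 0 := by
        intro j _
        have hl3 : HasDerivAt (fun t : ℝ => N j + t • u j) (u j) 0 := by
          simpa using ((hasDerivAt_id (0 : ℝ)).smul_const (u j)).const_add (N j)
        simpa using hl3.fun_pow (p j)
      have hc := HasDerivAt.fun_finsetProd hb
      have hd := (ha.const_mul (((∏ j, (p j).factorial : ℕ) : ℝ)⁻¹)).fun_smul hc
      simpa using hd
    rw [hGl] at h1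
    rw [h1.unique h2, Finset.sum_add_distrib]
    have hE : ∀ j, ∑ p ∈ teS m (n + 1),
        (((∏ i, (p i).factorial : ℕ) : ℝ)⁻¹ * multiDeriv (p + Pi.single j 1) g x) •
          ∏ i, N i ^ p i = ∑ p ∈ teS m n,
        (((∏ i, (p i).factorial : ℕ) : ℝ)⁻¹ * multiDeriv (p + Pi.single j 1) g x) •
          ∏ i, N i ^ p i := by
      intro j
      symm
      refine Finset.sum_subset (fun p hp => ?_) fun p _ hp => ?_
      · rw [te_mem_S] at hp ⊢
        omega
      · rw [te_mem_S] at hp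
        rw [te_prod_zero N (fun j => hN (X j)) p (not_lt.1 hp), smul_zero]
    have hA : ∑ p ∈ teS m (n + 1), (((∏ j, (p j).factorial : ℕ) : ℝ)⁻¹ * multiDeriv p g x) •
            (∑ j, (∏ i ∈ Finset.univ.erase j, N i ^ p i) * ((p j : A) * N j ^ (p j - 1) * u j))
        = ∑ j, u j * ∑ p ∈ teS m n,
        (((∏ i, (p i).factorial : ℕ) : ℝ)⁻¹ * multiDeriv (p + Pi.single j 1) g x) •
          ∏ i, N i ^ p i := by
      simp_rw [Finset.smul_sum]
      rw [Finset.sum_comm]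
      refine Finset.sum_congr rfl fun j _ => ?_
      rw [← te_shift n N (fun p => multiDeriv p g x) j, Finset.mul_sum]
      refine Finset.sum_congr rfl fun p _ => ?_
      rw [mul_smul_comm]
      congr 1
      ring
    have hB : ∑ p ∈ teS m (n + 1), (((∏ j, (p j).factorial : ℕ) : ℝ)⁻¹ *
              ∑ j, w j * multiDeriv (p + Pi.single j 1) g x) • ∏ j, N j ^ p j
        = ∑ j, algebraMap ℝ A (w j) * ∑ p ∈ teS m n,
        (((∏ i, (p i).factorial : ℕ) : ℝ)⁻¹ * multiDeriv (p + Pi.single j 1) g x) •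
          ∏ i, N i ^ p i := by
      simp_rw [← hE, Finset.mul_sum, Finset.sum_smul]
      rw [Finset.sum_comm]
      refine Finset.sum_congr rfl fun j _ => Finset.sum_congr rfl fun p _ => ?_
      rw [← Algebra.smul_def, smul_smul]
      congr 1
      ring
    rw [hA, hB, ← Finset.sum_add_distrib]
    refine Finset.sum_congr rfl fun j _ => ?_
    rw [← add_mul]
    congr 1
    simp [hu, hw]
  refine ⟨⟨hsm, fun X a v => ?_⟩, fun X => ?_⟩
  · rw [hD, hD, Finset.smul_sum]
    refine Finset.sum_congr rfl fun j _ => ?_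
    simp only [Pi.smul_apply, smul_eq_mul]
    ring
  · rw [hG, map_sum, Finset.sum_eq_single 0]
    · simp [te_multi_zero]
    · intro p _ hp
      obtain ⟨j, hj⟩ := Function.ne_iff.1 hp
      have hj2 : p j ≠ 0 := hj
      have h0 : ∏ i, π ((X i - algebraMap ℝ A (π (X i))) ^ p i) = 0 :=
        Finset.prod_eq_zero (Finset.mem_univ j) (by simp [hj2])
      rw [map_smul, map_prod, h0, smul_zero]
    · intro h
      exact absurd ((te_mem_S _).2 (by simp)) h
end

section
/- Let G : A^m → A be A-differentiable. Then the real part of G is a basic function: π(G(X)) = π(G(Y)) for all X, Y ∈ A^m with π(X^j) = π(Y^j) for all j = 1, …, m; i.e. π ∘ G factors through the map A^m → ℝ^m, X ↦ (π(X¹), …, π(X^m)). -/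
/-- The real part of an `A`-differentiable function `G : A^m → A` is a
basic function: `π (G X) = π (G Y)` whenever `π (X j) = π (Y j)` for all `j`. -/
theorem realPart_basic
    {A : Type*} [NormedCommRing A] [NormedAlgebra ℝ A] [FiniteDimensional ℝ A]
    [IsLocalRing A]
    (π : A →ₐ[ℝ] ℝ) (hπ : RingHom.ker (π : A →+* ℝ) = IsLocalRing.maximalIdeal A)
    {m : ℕ} (G : (Fin m → A) → A) (hG : ADiff G) :
    ∀ X Y : Fin m → A, (∀ j, π (X j) = π (Y j)) → π (G X) = π (G Y) := by
  intro X Y hXY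
  obtain ⟨hsmooth, hlin⟩ := hG
  have hdiff : Differentiable ℝ G := hsmooth.differentiable (by simp)
  have key : ∀ (Z v : Fin m → A), (∀ j, π (v j) = 0) → π (fderiv ℝ G Z v) = 0 := by
    intro Z v hv
    have hsum : v = ∑ j, v j • (Pi.single j (1 : A) : Fin m → A) :=
      pi_eq_sum_univ' v |>.trans (by
        refine Finset.sum_congr rfl fun j _ => ?_
        congr 1)
    rw [hsum, map_sum, map_sum]
    refine Finset.sum_eq_zero fun j _ => ?_
    rw [hlin, smul_eq_mul, map_mul, hv j, zero_mul]
  let P : A →L[ℝ] ℝ := LinearMap.toContinuousLinearMap π.toLinearMap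
  have hP : ∀ a, P a = π a := fun a => rfl
  have hd : ∀ t : ℝ, HasDerivAt (fun t : ℝ => P (G (Y + t • (X - Y)))) 0 t := by
    intro t
    have h1 : HasDerivAt (fun t : ℝ => Y + t • (X - Y)) (X - Y) t := by
      simpa using ((hasDerivAt_id t).smul_const (X - Y)).const_add Y
    have h2 := (hdiff (Y + t • (X - Y))).hasFDerivAt.comp_hasDerivAt t h1
    have h3 := P.hasFDerivAt.comp_hasDerivAt t h2
    have h4 : P (fderiv ℝ G (Y + t • (X - Y)) (X - Y)) = 0 := by
      rw [hP]
      exact key _ _ fun j => by simp [hXY j]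
    rw [h4] at h3
    exact h3
  have hc := is_const_of_deriv_eq_zero (fun t => (hd t).differentiableAt)
    (fun t => (hd t).deriv) 1 0
  simpa [hP] using hc
end
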